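/- Define f : [0,1] × [0,1] → [0,1] by f(x,y) = x if y ≤ 1/2 or x ≥ 1/2, and f(x,y) = (1/2)·(2x)^{1+(y−1/2)} if x ≤ 1/2 and y ≥ 1/2. Then for every y ∈ [0,1] the right translation R_y : [0,1] → [0,1], R_y(x) = f(x,y), is a homeomorphism of [0,1] onto itself; explicitly, for y = 1/2 + ε with ε > 0 its inverse is given by R_y^{-1}(x) = (1/2)·(2x)^{1/(1+ε)} for x ≤ 1/2 and R_y^{-1}(x) = x for x ≥ 1/2. -/

import Mathlib

open Set

/-- The quandle operation of Theorem 3.3: `f x y = x` if `y ≤ 1/2` or `x ≥ 1/2`,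
and `f x y = (1/2)·(2x)^(1+(y-1/2))` otherwise (real power). -/
noncomputable def f01 (x y : ℝ) : ℝ :=
  if y ≤ 1 / 2 ∨ 1 / 2 ≤ x then x else 1 / 2 * (2 * x) ^ (1 + (y - 1 / 2))

/-- The map equal to `x ↦ (1/2)·(2x)^a` for `x ≤ 1/2` and to the identity for `x > 1/2`. -/
noncomputable def halfPow (a x : ℝ) : ℝ :=
  if x ≤ 1 / 2 then 1 / 2 * (2 * x) ^ a else x

theorem continuous_halfPow {a : ℝ} (ha : 0 < a) : Continuous (halfPow a) := by
  refine Continuous.if_le ?_ continuous_id continuous_id continuous_const ?_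
  · exact continuous_const.mul
      ((continuous_const.mul continuous_id).rpow_const fun _ => Or.inr ha.le)
  · rintro x rfl
    norm_num

theorem half_mul_rpow_mem_Icc {a x : ℝ} (ha : 0 < a) (hx₀ : 0 ≤ x) (hx : x ≤ 1 / 2) :
    1 / 2 * (2 * x) ^ a ∈ Icc (0 : ℝ) (1 / 2) := by
  have hle : (2 * x) ^ a ≤ 1 := Real.rpow_le_one (by linarith) (by linarith) ha.le
  exact ⟨by positivity, by linarith⟩

theorem halfPow_mem_unitInterval {a x : ℝ} (ha : 0 < a) (hx : x ∈ unitInterval) :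
    halfPow a x ∈ unitInterval := by
  unfold halfPow
  split_ifs with h
  · have hmem := half_mul_rpow_mem_Icc ha hx.1 h
    exact ⟨hmem.1, by linarith [hmem.2]⟩
  · exact hx

theorem halfPow_halfPow {a b x : ℝ} (ha : 0 < a) (hab : a * b = 1) (hx : 0 ≤ x) :
    halfPow b (halfPow a x) = x := by
  by_cases h : x ≤ 1 / 2
  · have hpow : 2 * (1 / 2 * (2 * x) ^ a) = (2 * x) ^ a := by ring
    rw [halfPow, halfPow, if_pos h, if_pos (half_mul_rpow_mem_Icc ha hx h).2, hpow,
      ← Real.rpow_mul (by linarith), hab, Real.rpow_one]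
    ring
  · simp only [halfPow, if_neg h]

/-- For `a > 0`, the map `halfPow a` as a homeomorphism of the unit interval,
with inverse `halfPow (1 / a)`. -/
noncomputable def halfPowHomeomorph (a : ℝ) (ha : 0 < a) : unitInterval ≃ₜ unitInterval where
  toFun x := ⟨halfPow a x, halfPow_mem_unitInterval ha x.2⟩
  invFun x := ⟨halfPow (1 / a) x, halfPow_mem_unitInterval (one_div_pos.2 ha) x.2⟩
  left_inv x := Subtype.ext (halfPow_halfPow ha (mul_one_div_cancel ha.ne') x.2.1)
  right_inv x := Subtype.ext
    (halfPow_halfPow (one_div_pos.2 ha) (one_div_mul_cancel ha.ne') x.2.1)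
  continuous_toFun := ((continuous_halfPow ha).comp continuous_subtype_val).subtype_mk _
  continuous_invFun :=
    ((continuous_halfPow (one_div_pos.2 ha)).comp continuous_subtype_val).subtype_mk _

theorem f01_eq_halfPow {x y : ℝ} (hy : 1 / 2 < y) : f01 x y = halfPow (1 + (y - 1 / 2)) x := by
  unfold f01 halfPow
  rcases lt_trichotomy x (1 / 2) with h | rfl | h
  · rw [if_neg (by simp only [not_or, not_le]; exact ⟨hy, h⟩), if_pos h.le]
  · norm_num
  · rw [if_pos (Or.inr h.le), if_neg (not_le.2 h)]

/-- For every `y ∈ [0,1]`, the right translation `R_y : x ↦ f01 x y` is a homeomorphism of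
`[0,1]`, and if `y = 1/2 + ε` with `ε > 0` then its inverse is
`x ↦ (1/2)·(2x)^(1/(1+ε))` for `x ≤ 1/2` and the identity for `x ≥ 1/2`. -/
theorem stmt3 :
    ∀ y : unitInterval, ∃ h : unitInterval ≃ₜ unitInterval,
      (∀ x : unitInterval, (h x : ℝ) = f01 x y) ∧
      (∀ ε : ℝ, 0 < ε → (y : ℝ) = 1 / 2 + ε →
        ∀ x : unitInterval, (h.symm x : ℝ) =
          if (x : ℝ) ≤ 1 / 2 then 1 / 2 * (2 * (x : ℝ)) ^ (1 / (1 + ε)) else (x : ℝ)) := by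
  intro y
  rcases le_or_gt (y : ℝ) (1 / 2) with hy | hy
  · refine ⟨Homeomorph.refl _, fun x => ?_, fun ε hε h => ?_⟩
    · rw [f01, if_pos (Or.inl hy)]
      rfl
    · linarith
  · refine ⟨halfPowHomeomorph (1 + ((y : ℝ) - 1 / 2)) (by linarith),
      fun x => (f01_eq_halfPow hy).symm, fun ε _ h x => ?_⟩
    have hε : ε = (y : ℝ) - 1 / 2 := by linarith
    subst hε
    rfl
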